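/- Let p be an odd prime and let a ∈ ℚ_p with |a|_p > 1. Define f : ℤ_p → ℚ_p by f(t) := ζ_{p,E}(t,a) − ⟨a⟩^{1−t}, and set P_0(s) := 2/(s−1), P_1(s) := 1/ω_v(a), and P_n(s) := (∏_{j=1}^{n−1}(s−1+j)) / (n!·ω_v(a)^n) for n ≥ 2. Then for every s ∈ ℤ_p with s ≠ 1, the series Σ_{n=0}^∞ P_n(s)·(Σ_{k=0}^∞ (n^k/k!)·D^k f(s)) converges in ℚ_p, where D^k f denotes the k-th iterated derivative of f within ℤ_p (with D^0 f = f), each inner series being convergent. -/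

import Mathlib

open Filter Topology

noncomputable def teich (p : ℕ) [Fact p.Prime] (u : ℚ_[p]) : ℚ_[p] :=
  limUnder atTop fun n : ℕ => u ^ p ^ n

noncomputable def omegaV (p : ℕ) [Fact p.Prime] (a : ℚ_[p]) : ℚ_[p] :=
  (p : ℚ_[p]) ^ a.valuation * teich p (a * (p : ℚ_[p]) ^ (-a.valuation))

noncomputable def proj (p : ℕ) [Fact p.Prime] (a : ℚ_[p]) : ℚ_[p] :=
  a / omegaV p a

noncomputable def binom (p : ℕ) [Fact p.Prime] (s : ℚ_[p]) (n : ℕ) : ℚ_[p] :=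
  (∏ j ∈ Finset.range n, (s - (j : ℚ_[p]))) / (n.factorial : ℚ_[p])

noncomputable def hpow (p : ℕ) [Fact p.Prime] (a s : ℚ_[p]) : ℚ_[p] :=
  ∑' n : ℕ, binom p s n * (proj p a - 1) ^ n

noncomputable def zetaE (p : ℕ) [Fact p.Prime] (s a : ℚ_[p]) : ℚ_[p] :=
  limUnder atTop fun r : ℕ =>
    ∑ k ∈ Finset.range (p ^ r), (-1 : ℚ_[p]) ^ k * hpow p ((k : ℚ_[p]) + a) (1 - s)

noncomputable def coeffT (p : ℕ) [Fact p.Prime] (s a : ℚ_[p]) (n : ℕ) : ℚ_[p] :=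
  (∏ j ∈ Finset.Icc 1 (n - 1), (s - 1 + (j : ℚ_[p]))) /
    ((n.factorial : ℚ_[p]) * omegaV p a ^ n)

/-- The closed unit ball `ℤ_p` regarded as a subset of `ℚ_p`. -/
def Zball (p : ℕ) [Fact p.Prime] : Set ℚ_[p] := {x : ℚ_[p] | ‖x‖ ≤ 1}

/-- The coefficients `P_{p,n}^a(s)` of the p-adic Van Gorder operator `T_p^a`. -/
noncomputable def Pcoef (p : ℕ) [Fact p.Prime] (s a : ℚ_[p]) : ℕ → ℚ_[p]
  | 0 => 2 / (s - 1)
  | 1 => 1 / omegaV p a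
  | n + 2 => coeffT p s a (n + 2)

section PadicEstimates

variable {p : ℕ} [hp : Fact p.Prime]

lemma padic_pow_mul_inv_norm_factorial_le (hodd : p ≠ 2) (n : ℕ) :
    ((p : ℝ)⁻¹) ^ n * ‖(n.factorial : ℚ_[p])‖⁻¹ ≤ (√((p : ℝ)⁻¹)) ^ n := by
  have hp3 : 2 ≤ p - 1 := by have := hp.out.two_le; omega
  have hv : 2 * padicValNat p n.factorial ≤ n := by
    calc 2 * padicValNat p n.factorial ≤ (p - 1) * padicValNat p n.factorial := by gcongr
      _ ≤ n := by rw [sub_one_mul_padicValNat_factorial]; omega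
  have hp0 : (0 : ℝ) < (p : ℝ)⁻¹ := inv_pos.2 (mod_cast hp.out.pos)
  have hp1 : (p : ℝ)⁻¹ ≤ 1 := inv_le_one_of_one_le₀ (mod_cast hp.out.one_le)
  have hn0 : (n.factorial : ℚ_[p]) ≠ 0 := mod_cast n.factorial_ne_zero
  rw [Padic.norm_eq_zpow_neg_valuation hn0, Padic.valuation_natCast, zpow_neg, inv_inv,
    zpow_natCast]
  have hsq : (p : ℝ)⁻¹ = √((p : ℝ)⁻¹) ^ 2 := (Real.sq_sqrt hp0.le).symm
  obtain ⟨w, hw⟩ := Nat.exists_eq_add_of_le hv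
  have hpv : ((p : ℝ)⁻¹) ^ padicValNat p n.factorial * (p : ℝ) ^ padicValNat p n.factorial = 1 := by
    rw [← mul_pow, inv_mul_cancel₀ (mod_cast hp.out.ne_zero), one_pow]
  calc ((p : ℝ)⁻¹) ^ n * (p : ℝ) ^ padicValNat p n.factorial
      = ((p : ℝ)⁻¹) ^ (n - padicValNat p n.factorial) := by
        conv_lhs => rw [show n = (n - padicValNat p n.factorial) + padicValNat p n.factorial by omega]
        rw [pow_add, mul_assoc]
        rw [show n - padicValNat p n.factorial + padicValNat p n.factorial = n by omega, hpv, mul_one]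
    _ = √((p : ℝ)⁻¹) ^ (2 * (n - padicValNat p n.factorial)) := by rw [pow_mul, ← hsq]
    _ ≤ √((p : ℝ)⁻¹) ^ n :=
        pow_le_pow_of_le_one (Real.sqrt_nonneg _) (Real.sqrt_le_one.2 hp1) (by omega)

lemma padicInt_norm_pow_prime_sub_self_lt_one (z : ℤ_[p]) : ‖z ^ p - z‖ < 1 := by
  rw [← PadicInt.mem_nonunits, ← IsLocalRing.mem_maximalIdeal, ← PadicInt.ker_toZMod,
    RingHom.mem_ker, map_sub, map_pow, ZMod.pow_card, sub_self]

lemma padic_norm_pow_prime_pow_sub_le {x y : ℚ_[p]} (hx : ‖x‖ ≤ 1) (hy : ‖y‖ ≤ 1)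
    (hxy : ‖x - y‖ < 1) (n : ℕ) :
    ‖x ^ p ^ n - y ^ p ^ n‖ ≤ ((p : ℝ)⁻¹) ^ (n + 1) := by
  have hdvd : (p : ℤ_[p]) ∣ (⟨x, hx⟩ - ⟨y, hy⟩ : ℤ_[p]) :=
    (PadicInt.norm_lt_one_iff_dvd _).1 hxy
  obtain ⟨c, hc⟩ := dvd_sub_pow_of_dvd_sub hdvd n
  have := congrArg norm hc
  rw [norm_mul, norm_pow, PadicInt.norm_p] at this
  change ‖x ^ p ^ n - y ^ p ^ n‖ = _ at this
  rw [this]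
  exact mul_le_of_le_one_right (by positivity) (PadicInt.norm_le_one c)

lemma padic_norm_sub_le_max (x y : ℚ_[p]) : ‖x - y‖ ≤ max ‖x‖ ‖y‖ := by
  simpa [sub_eq_add_neg] using Padic.nonarchimedean x (-y)

lemma padic_norm_pow_le_one {x : ℚ_[p]} (hx : ‖x‖ ≤ 1) (n : ℕ) : ‖x ^ n‖ ≤ 1 := by
  rw [norm_pow]; exact pow_le_one₀ (norm_nonneg _) hx

lemma padic_norm_le_inv_of_lt_one {x : ℚ_[p]} (hx : ‖x‖ < 1) : ‖x‖ ≤ (p : ℝ)⁻¹ := by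
  have := (Padic.norm_le_pow_iff_norm_lt_pow_add_one x (-1)).2 (by simpa using hx)
  simpa using this

lemma padic_norm_pow_succ_sub_le {u : ℚ_[p]} (hu : ‖u‖ ≤ 1) (n : ℕ) :
    ‖u ^ p ^ (n + 1) - u ^ p ^ n‖ ≤ ((p : ℝ)⁻¹) ^ (n + 1) := by
  rw [pow_succ' p n, pow_mul]
  exact padic_norm_pow_prime_pow_sub_le (padic_norm_pow_le_one hu p) hu
    (padicInt_norm_pow_prime_sub_self_lt_one ⟨u, hu⟩) n

lemma inv_prime_lt_one : (p : ℝ)⁻¹ < 1 := inv_lt_one_of_one_lt₀ (mod_cast hp.out.one_lt)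

lemma tendsto_teich {u : ℚ_[p]} (hu : ‖u‖ ≤ 1) :
    Tendsto (fun n : ℕ => u ^ p ^ n) atTop (𝓝 (teich p u)) := by
  refine CauchySeq.tendsto_limUnder
    (cauchySeq_of_le_geometric (p : ℝ)⁻¹ (p : ℝ)⁻¹ inv_prime_lt_one fun n => ?_)
  rw [dist_comm, dist_eq_norm, ← pow_succ']
  exact padic_norm_pow_succ_sub_le hu n

lemma norm_teich_sub_le {u : ℚ_[p]} (hu : ‖u‖ ≤ 1) : ‖teich p u - u‖ ≤ (p : ℝ)⁻¹ := by
  refine le_of_tendsto' ((tendsto_teich hu).sub_const u).norm fun n => ?_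
  induction n with
  | zero => simp
  | succ n ih =>
    rw [← sub_add_sub_cancel _ (u ^ p ^ n)]
    refine (Padic.nonarchimedean _ _).trans (max_le ?_ ih)
    refine (padic_norm_pow_succ_sub_le hu n).trans ?_
    exact pow_le_of_le_one (by positivity) inv_prime_lt_one.le (by omega)

lemma teich_congr {u v : ℚ_[p]} (hu : ‖u‖ ≤ 1) (hv : ‖v‖ ≤ 1) (huv : ‖u - v‖ < 1) :
    teich p u = teich p v := by
  have h0 : Tendsto (fun n : ℕ => u ^ p ^ n - v ^ p ^ n) atTop (𝓝 0) :=
    squeeze_zero_norm (fun n => padic_norm_pow_prime_pow_sub_le hu hv huv n)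
      ((tendsto_pow_atTop_nhds_zero_of_lt_one (by positivity) inv_prime_lt_one).comp
        (tendsto_add_atTop_nat 1))
  exact sub_eq_zero.1 (tendsto_nhds_unique ((tendsto_teich hu).sub (tendsto_teich hv)) h0)

lemma padic_norm_unit_part {a : ℚ_[p]} (ha : a ≠ 0) :
    ‖a * (p : ℚ_[p]) ^ (-a.valuation)‖ = 1 := by
  rw [norm_mul, Padic.norm_p_zpow, Padic.norm_eq_zpow_neg_valuation ha, neg_neg,
    ← zpow_add₀ (mod_cast hp.out.ne_zero), neg_add_cancel, zpow_zero]

lemma norm_teich {u : ℚ_[p]} (hu : ‖u‖ = 1) : ‖teich p u‖ = 1 := by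
  refine tendsto_nhds_unique (tendsto_teich hu.le).norm ?_
  simp [hu]

lemma norm_omegaV {a : ℚ_[p]} (ha : a ≠ 0) : ‖omegaV p a‖ = ‖a‖ := by
  rw [omegaV, norm_mul, norm_teich (padic_norm_unit_part ha), Padic.norm_p_zpow, mul_one,
    Padic.norm_eq_zpow_neg_valuation ha]

lemma omegaV_ne_zero {a : ℚ_[p]} (ha : a ≠ 0) : omegaV p a ≠ 0 := by
  rw [← norm_pos_iff, norm_omegaV ha]; exact norm_pos_iff.2 ha

lemma norm_proj_sub_one_le {a : ℚ_[p]} (ha : a ≠ 0) : ‖proj p a - 1‖ ≤ (p : ℝ)⁻¹ := by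
  have hu := padic_norm_unit_part ha
  have hp0 : (p : ℚ_[p]) ≠ 0 := mod_cast hp.out.ne_zero
  have ht : teich p (a * (p : ℚ_[p]) ^ (-a.valuation)) ≠ 0 := by
    rw [← norm_pos_iff, norm_teich hu]; exact one_pos
  have : proj p a - 1 = (a * (p : ℚ_[p]) ^ (-a.valuation)
      - teich p (a * (p : ℚ_[p]) ^ (-a.valuation)))
        / teich p (a * (p : ℚ_[p]) ^ (-a.valuation)) := by
    rw [proj, omegaV, sub_div, div_self ht, zpow_neg, ← div_eq_mul_inv, div_div]
  rw [this, norm_div, norm_teich hu, div_one, norm_sub_rev]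
  exact norm_teich_sub_le hu.le

lemma padic_norm_natCast_add {a : ℚ_[p]} (ha : 1 < ‖a‖) (k : ℕ) : ‖(k : ℚ_[p]) + a‖ = ‖a‖ := by
  have hk : ‖(k : ℚ_[p])‖ < ‖a‖ := (IsUltrametricDist.norm_natCast_le_one _ k).trans_lt ha
  rw [Padic.add_eq_max_of_ne hk.ne, max_eq_right hk.le]

lemma omegaV_natCast_add {a : ℚ_[p]} (ha : 1 < ‖a‖) (k : ℕ) :
    omegaV p ((k : ℚ_[p]) + a) = omegaV p a := by
  have ha0 : a ≠ 0 := norm_pos_iff.1 (one_pos.trans ha)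
  have hn := padic_norm_natCast_add ha k
  have hka0 : (k : ℚ_[p]) + a ≠ 0 := norm_pos_iff.1 (by rw [hn]; exact one_pos.trans ha)
  have hp1 : (1 : ℝ) < p := mod_cast hp.out.one_lt
  have hval : ((k : ℚ_[p]) + a).valuation = a.valuation := by
    rw [Padic.norm_eq_zpow_neg_valuation hka0, Padic.norm_eq_zpow_neg_valuation ha0] at hn
    exact neg_inj.1 (zpow_right_injective₀ (one_pos.trans hp1) hp1.ne' hn)
  have hu := padic_norm_unit_part ha0
  have hku := padic_norm_unit_part hka0
  rw [omegaV, omegaV, teich_congr hku.le hu.le, hval]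
  rw [hval, ← sub_mul, add_sub_cancel_right, norm_mul]
  have hlt : ‖(p : ℚ_[p]) ^ (-a.valuation)‖ < 1 := by
    rw [norm_mul] at hu
    by_contra! h
    nlinarith [norm_nonneg ((p : ℚ_[p]) ^ (-a.valuation))]
  calc _ ≤ 1 * ‖(p : ℚ_[p]) ^ (-a.valuation)‖ := by
        gcongr; exact IsUltrametricDist.norm_natCast_le_one _ k
    _ < 1 := by rwa [one_mul]

lemma proj_natCast_add {a : ℚ_[p]} (ha : 1 < ‖a‖) (k : ℕ) :
    proj p ((k : ℚ_[p]) + a) = ((k : ℚ_[p]) + a) / omegaV p a := by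
  rw [proj, omegaV_natCast_add ha]

end PadicEstimates

section PowerSeries

variable {p : ℕ} [hp : Fact p.Prime]

lemma exists_integral_expansion (s : ℚ_[p]) (hs : ‖s‖ ≤ 1) (n : ℕ) :
    ∃ e : ℕ → ℚ_[p], (∀ m, ‖e m‖ ≤ 1) ∧ (∀ m, n < m → e m = 0) ∧
      ∀ y : ℚ_[p], HasSum (fun m => e m * y ^ m)
        (∏ j ∈ Finset.range n, (1 - (s + y) - (j : ℚ_[p]))) := by
  obtain ⟨z, rfl⟩ : ∃ z : ℤ_[p], (z : ℚ_[p]) = s := ⟨⟨s, hs⟩, rfl⟩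
  let q : Polynomial ℤ_[p] := ∏ j ∈ Finset.range n,
    (Polynomial.C (1 - z - (j : ℤ_[p])) - Polynomial.X)
  have hdeg : q.natDegree ≤ n := by
    refine (Polynomial.natDegree_prod_le _ _).trans ?_
    refine (Finset.sum_le_card_nsmul _ _ 1 fun j _ => ?_).trans (by simp)
    compute_degree
  have hzero : ∀ m, n < m → ((q.coeff m : ℤ_[p]) : ℚ_[p]) = 0 := fun m hm => by
    rw [Polynomial.coeff_eq_zero_of_natDegree_lt (hdeg.trans_lt hm), PadicInt.coe_zero]
  refine ⟨fun m => q.coeff m, fun m => PadicInt.norm_le_one _, hzero, fun y => ?_⟩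
  have heval : ∏ j ∈ Finset.range n, (1 - (z + y) - (j : ℚ_[p]))
      = q.eval₂ PadicInt.Coe.ringHom y := by
    rw [Polynomial.eval₂_finsetProd]
    refine Finset.prod_congr rfl fun j _ => ?_
    rw [Polynomial.eval₂_sub, Polynomial.eval₂_C, Polynomial.eval₂_X, map_sub, map_sub, map_one,
      map_natCast]
    change _ = 1 - (z : ℚ_[p]) - (j : ℚ_[p]) - y
    ring
  rw [heval, Polynomial.eval₂_eq_sum_range' _ (Nat.lt_succ_of_le hdeg)]
  refine hasSum_sum_of_ne_finset_zero fun m hm => ?_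
  have hm0 : ((q.coeff m : ℤ_[p]) : ℚ_[p]) = 0 := hzero m (by simpa using hm)
  exact mul_eq_zero_of_left hm0 _

/-- A Mahler-type series in `1 - t` with geometrically decaying coefficients is analytic on `ℤ_p`,
with geometrically decaying Taylor coefficients. -/
lemma norm_iteratedDerivWithin_div_factorial_le {b : ℕ → ℚ_[p]} {σ : ℝ} (hσ0 : 0 ≤ σ) (hσ1 : σ < 1)
    (hb : ∀ n, ‖b n‖ ≤ (σ ^ 2) ^ n) {F : ℚ_[p] → ℚ_[p]}
    (hF : ∀ t, ‖t‖ ≤ 1 → F t = ∑' n, (∏ j ∈ Finset.range n, (1 - t - (j : ℚ_[p]))) * b n)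
    {s : ℚ_[p]} (hs : ‖s‖ ≤ 1) (m : ℕ) :
    ‖iteratedDerivWithin m F (Zball p) s / (m.factorial : ℚ_[p])‖ ≤ σ ^ m := by
  choose e he1 he0 hesum using exists_integral_expansion s hs
  have hterm : ∀ n m, ‖e n m * b n‖ ≤ σ ^ n * σ ^ m := fun n m => by
    rcases lt_or_ge n m with h | h
    · rw [he0 n m h, zero_mul, norm_zero]; positivity
    · calc ‖e n m * b n‖ ≤ 1 * (σ ^ 2) ^ n := by
            rw [norm_mul]; gcongr <;> apply_rules
        _ = σ ^ n * σ ^ n := by ring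
        _ ≤ σ ^ n * σ ^ m := by
            gcongr ?_ * ?_; exact pow_le_pow_of_le_one hσ0 hσ1.le h
  have hgeo := summable_geometric_of_lt_one hσ0 hσ1
  set c : ℕ → ℚ_[p] := fun m => ∑' n, e n m * b n with hc
  have hcm : ∀ m, ‖c m‖ ≤ σ ^ m := fun m =>
    IsUltrametricDist.norm_tsum_le_of_forall_le_of_nonneg (by positivity) fun n =>
      (hterm n m).trans (mul_le_of_le_one_left (by positivity) (pow_le_one₀ hσ0 hσ1.le))
  have hsum : ∀ y : ℚ_[p], ‖y‖ ≤ 1 → HasSum (fun m => c m * y ^ m) (F (s + y)) := fun y hy => by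
    have hS : Summable fun x : ℕ × ℕ => e x.1 x.2 * y ^ x.2 * b x.1 := by
      refine Summable.of_norm_bounded (hgeo.mul_of_nonneg hgeo (fun n => by positivity)
        (fun n => by positivity)) fun x => ?_
      rw [mul_right_comm, norm_mul]
      exact (mul_le_of_le_one_right (norm_nonneg _) (padic_norm_pow_le_one hy _)).trans (hterm _ _)
    have hFs : F (s + y) = ∑' x : ℕ × ℕ, e x.1 x.2 * y ^ x.2 * b x.1 := by
      rw [hF _ ((Padic.nonarchimedean s y).trans (max_le hs hy)), hS.tsum_prod]
      exact tsum_congr fun n => ((hesum n y).mul_right _).tsum_eq.symm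
    have h2 := (Equiv.prodComm ℕ ℕ).hasSum_iff.2 hS.hasSum
    rw [← hFs] at h2
    refine h2.prod_fiberwise fun m => ?_
    have h3 : Summable fun n => e n m * b n :=
      Summable.of_norm_bounded (hgeo.mul_right (σ ^ m)) fun n => hterm n m
    convert! h3.hasSum.mul_right (y ^ m) using 2
    simp only [Function.comp, Equiv.prodComm_apply, Prod.swap]
    ring
  have hps : HasFPowerSeriesOnBall F (FormalMultilinearSeries.ofScalars ℚ_[p] c) s 1 := by
    refine ⟨?_, one_pos, fun {y} hy => ?_⟩
    · refine FormalMultilinearSeries.le_radius_of_bound _ 1 (r := 1) fun n => ?_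
      rw [FormalMultilinearSeries.ofScalars_norm]
      simpa using (hcm n).trans (pow_le_one₀ hσ0 hσ1.le)
    · have hy1 : ‖y‖ ≤ 1 := by
        have : y ∈ Metric.ball (0 : ℚ_[p]) 1 := by
          rw [← Metric.eball_ofReal]; simpa using hy
        exact (mem_ball_zero_iff.1 this).le
      simpa [FormalMultilinearSeries.ofScalars_apply_eq, mul_comm] using hsum y hy1
  have hopen : IsOpen (Zball p) := by
    have : Zball p = Metric.closedBall (0 : ℚ_[p]) 1 := by ext x; simp [Zball]
    rw [this]
    exact IsUltrametricDist.isOpen_closedBall _ one_ne_zero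
  have hcoeff := hps.hasFPowerSeriesAt.eq_formalMultilinearSeries
    hps.analyticAt.hasFPowerSeriesAt
  rw [FormalMultilinearSeries.ofScalars_series_eq_iff] at hcoeff
  rw [iteratedDerivWithin_of_isOpen hopen hs, ← congrFun hcoeff m]
  exact hcm m

end PowerSeries

section AlternatingSums

variable {p : ℕ} [hp : Fact p.Prime]

lemma sum_range_mul_eq {M : Type*} [AddCommMonoid M] (h : ℕ → M) (N q : ℕ) :
    ∑ k ∈ Finset.range (N * q), h k
      = ∑ j ∈ Finset.range q, ∑ k ∈ Finset.range N, h (k + N * j) := by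
  induction q with
  | zero => simp
  | succ q ih =>
    rw [Nat.mul_succ, Finset.sum_range_add, ih, Finset.sum_range_succ]
    simp only [add_comm]

lemma padic_norm_neg_one_pow_mul (k : ℕ) (x : ℚ_[p]) : ‖(-1 : ℚ_[p]) ^ k * x‖ = ‖x‖ := by
  simp

lemma cauchySeq_alternating_sum (hodd : p ≠ 2) {g : ℕ → ℚ_[p]}
    (hg : ∀ r j k, ‖g (k + p ^ r * j) - g k‖ ≤ ((p : ℝ)⁻¹) ^ r) :
    CauchySeq fun r : ℕ => ∑ k ∈ Finset.range (p ^ r), (-1 : ℚ_[p]) ^ k * g k := by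
  refine cauchySeq_of_le_geometric (p : ℝ)⁻¹ 1 inv_prime_lt_one fun r => ?_
  have hpo : Odd p := hp.out.odd_of_ne_two hodd
  have hone : ∑ j ∈ Finset.range p, (-1 : ℚ_[p]) ^ j = 1 := by
    rw [neg_one_geom_sum, if_neg (Nat.not_even_iff_odd.2 hpo)]
  have hdiff : ∑ k ∈ Finset.range (p ^ (r + 1)), (-1 : ℚ_[p]) ^ k * g k
      - ∑ k ∈ Finset.range (p ^ r), (-1 : ℚ_[p]) ^ k * g k
      = ∑ j ∈ Finset.range p, ∑ k ∈ Finset.range (p ^ r),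
        (-1 : ℚ_[p]) ^ (k + j) * (g (k + p ^ r * j) - g k) := by
    have h1 : ∑ k ∈ Finset.range (p ^ r), (-1 : ℚ_[p]) ^ k * g k
        = ∑ j ∈ Finset.range p, ∑ k ∈ Finset.range (p ^ r), (-1 : ℚ_[p]) ^ (k + j) * g k := by
      refine Eq.trans (b := (∑ j ∈ Finset.range p, (-1 : ℚ_[p]) ^ j) *
        ∑ k ∈ Finset.range (p ^ r), (-1 : ℚ_[p]) ^ k * g k) (by rw [hone, one_mul]) ?_
      rw [Finset.sum_mul]
      refine Finset.sum_congr rfl fun j _ => ?_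
      rw [Finset.mul_sum]
      exact Finset.sum_congr rfl fun k _ => by ring
    rw [h1, pow_succ, sum_range_mul_eq, ← Finset.sum_sub_distrib]
    refine Finset.sum_congr rfl fun j _ => ?_
    rw [← Finset.sum_sub_distrib]
    refine Finset.sum_congr rfl fun k _ => ?_
    have : (-1 : ℚ_[p]) ^ (k + p ^ r * j) = (-1) ^ (k + j) := by
      rw [pow_add, pow_mul, (hpo.pow).neg_one_pow, pow_add]
    rw [this, mul_sub]
  rw [dist_comm, dist_eq_norm, hdiff, one_mul]
  refine IsUltrametricDist.norm_sum_le_of_forall_le_of_nonneg (by positivity) fun j _ =>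
    IsUltrametricDist.norm_sum_le_of_forall_le_of_nonneg (by positivity) fun k _ => ?_
  rw [padic_norm_neg_one_pow_mul]
  exact hg r j k

lemma padic_norm_pow_sub_pow_le {x y : ℚ_[p]} (hx : ‖x‖ ≤ 1) (hy : ‖y‖ ≤ 1) (n : ℕ) :
    ‖x ^ n - y ^ n‖ ≤ ‖x - y‖ := by
  rw [← (Commute.all x y).geom_sum₂_mul, norm_mul]
  refine mul_le_of_le_one_left (norm_nonneg _)
    (IsUltrametricDist.norm_sum_le_of_forall_le_of_nonneg zero_le_one fun i _ => ?_)
  rw [norm_mul]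
  exact mul_le_one₀ (padic_norm_pow_le_one hx _) (norm_nonneg _) (padic_norm_pow_le_one hy _)

lemma padic_norm_prod_le_one {t : ℚ_[p]} (ht : ‖t‖ ≤ 1) (n : ℕ) :
    ‖∏ j ∈ Finset.range n, (t - (j : ℚ_[p]))‖ ≤ 1 := by
  rw [norm_prod]
  refine Finset.prod_le_one (fun _ _ => norm_nonneg _) fun j _ => ?_
  exact (padic_norm_sub_le_max _ _).trans
    (max_le ht (IsUltrametricDist.norm_natCast_le_one _ j))

lemma padic_norm_one_sub_le_one {t : ℚ_[p]} (ht : ‖t‖ ≤ 1) : ‖1 - t‖ ≤ 1 :=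
  (padic_norm_sub_le_max _ _).trans (max_le norm_one.le ht)

lemma norm_binom_mul_le (hodd : p ≠ 2) {t x : ℚ_[p]} (ht : ‖t‖ ≤ 1) {n : ℕ}
    (hx : ‖x‖ ≤ ((p : ℝ)⁻¹) ^ n) : ‖binom p t n * x‖ ≤ (√((p : ℝ)⁻¹)) ^ n := by
  refine le_trans ?_ (padic_pow_mul_inv_norm_factorial_le hodd n)
  rw [binom, norm_mul, norm_div, div_mul_eq_mul_div, mul_comm, div_eq_mul_inv]
  gcongr
  exact (mul_le_of_le_one_right (norm_nonneg _) (padic_norm_prod_le_one ht n)).trans hx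

lemma sqrt_inv_prime_lt_one : √((p : ℝ)⁻¹) < 1 := by
  rw [Real.sqrt_lt' one_pos, one_pow]; exact inv_prime_lt_one

/-- `ζ_{p,E}(t, a) - ⟨a⟩^{1-t}` is a Mahler series in `1 - t` with coefficients of size `p^{-n}`. -/
lemma exists_zetaE_sub_hpow_eq_tsum (hodd : p ≠ 2) {a : ℚ_[p]} (ha : 1 < ‖a‖) :
    ∃ B : ℕ → ℚ_[p], (∀ n, ‖B n‖ ≤ ((p : ℝ)⁻¹) ^ n) ∧
      ∀ t, ‖t‖ ≤ 1 → zetaE p t a - hpow p a (1 - t) = ∑' n, binom p (1 - t) n * B n := by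
  have ha0 : a ≠ 0 := norm_pos_iff.1 (one_pos.trans ha)
  have hx : ∀ k : ℕ, ‖proj p ((k : ℚ_[p]) + a) - 1‖ ≤ (p : ℝ)⁻¹ := fun k =>
    norm_proj_sub_one_le (norm_pos_iff.1 (by rw [padic_norm_natCast_add ha]; exact one_pos.trans ha))
  have hx1 : ∀ k : ℕ, ‖proj p ((k : ℚ_[p]) + a) - 1‖ ≤ 1 := fun k =>
    (hx k).trans inv_prime_lt_one.le
  have hxn : ∀ k n : ℕ, ‖(proj p ((k : ℚ_[p]) + a) - 1) ^ n‖ ≤ ((p : ℝ)⁻¹) ^ n := fun k n => by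
    rw [norm_pow]; gcongr; exact hx k
  have hlip : ∀ n r j k : ℕ, ‖(proj p (((k + p ^ r * j : ℕ) : ℚ_[p]) + a) - 1) ^ n
      - (proj p ((k : ℚ_[p]) + a) - 1) ^ n‖ ≤ ((p : ℝ)⁻¹) ^ r := fun n r j k => by
    refine (padic_norm_pow_sub_pow_le (hx1 _) (hx1 _) n).trans ?_
    rw [proj_natCast_add ha, proj_natCast_add ha]
    have : (((k + p ^ r * j : ℕ) : ℚ_[p]) + a) / omegaV p a - 1
        - (((k : ℚ_[p]) + a) / omegaV p a - 1)
        = (p : ℚ_[p]) ^ r * ((j : ℚ_[p]) * (omegaV p a)⁻¹) := by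
      push_cast; ring
    rw [this, norm_mul, norm_pow, Padic.norm_p, norm_mul, norm_inv, norm_omegaV ha0]
    refine mul_le_of_le_one_right (by positivity) ?_
    exact mul_le_one₀ (IsUltrametricDist.norm_natCast_le_one _ j) (by positivity)
      (inv_le_one_of_one_le₀ ha.le)
  set M : ℕ → ℕ → ℚ_[p] := fun r n =>
    ∑ k ∈ Finset.range (p ^ r), (-1 : ℚ_[p]) ^ k * (proj p ((k : ℚ_[p]) + a) - 1) ^ n with hM
  have hMn : ∀ r n, ‖M r n‖ ≤ ((p : ℝ)⁻¹) ^ n := fun r n =>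
    IsUltrametricDist.norm_sum_le_of_forall_le_of_nonneg (by positivity) fun k _ => by
      rw [padic_norm_neg_one_pow_mul]; exact hxn k n
  have hlim : ∀ n, ∃ L, Tendsto (fun r => M r n) atTop (𝓝 L) := fun n =>
    cauchySeq_tendsto_of_complete (cauchySeq_alternating_sum hodd (hlip n))
  choose L hL using hlim
  have hLn : ∀ n, ‖L n‖ ≤ ((p : ℝ)⁻¹) ^ n := fun n => le_of_tendsto' (hL n).norm fun r => hMn r n
  have hx0 : ∀ n, ‖(proj p a - 1) ^ n‖ ≤ ((p : ℝ)⁻¹) ^ n := fun n => by simpa using hxn 0 n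
  refine ⟨fun n => L n - (proj p a - 1) ^ n, fun n =>
    (padic_norm_sub_le_max _ _).trans (max_le (hLn n) (hx0 n)), fun t ht => ?_⟩
  have ht1 := padic_norm_one_sub_le_one ht
  have hgeo := summable_geometric_of_lt_one (Real.sqrt_nonneg (p : ℝ)⁻¹) sqrt_inv_prime_lt_one
  have hsum : ∀ {x : ℕ → ℚ_[p]}, (∀ n, ‖x n‖ ≤ ((p : ℝ)⁻¹) ^ n) →
      Summable fun n => binom p (1 - t) n * x n := fun hx =>
    Summable.of_norm_bounded hgeo fun n => norm_binom_mul_le hodd ht1 (hx n)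
  have hzeta : zetaE p t a = ∑' n, binom p (1 - t) n * L n := by
    refine Tendsto.limUnder_eq ?_
    have hS : ∀ r : ℕ, ∑ k ∈ Finset.range (p ^ r), (-1 : ℚ_[p]) ^ k * hpow p ((k : ℚ_[p]) + a) (1 - t)
        = ∑' n, binom p (1 - t) n * M r n := fun r => by
      simp only [hpow, hM, ← tsum_mul_left, Finset.mul_sum]
      rw [← Summable.tsum_finsetSum fun k _ => (hsum (hxn k)).mul_left _]
      exact tsum_congr fun n => Finset.sum_congr rfl fun k _ => by ring
    simp only [hS]
    exact tendsto_tsum_of_dominated_convergence hgeo (fun n => (hL n).const_mul _)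
      (Eventually.of_forall fun r n => norm_binom_mul_le hodd ht1 (hMn r n))
  rw [hzeta, hpow, ← (hsum hLn).tsum_sub (hsum hx0)]
  exact tsum_congr fun n => by ring

lemma norm_coeffT_le (hodd : p ≠ 2) {s a : ℚ_[p]} (hs : ‖s‖ ≤ 1) (ha : 1 < ‖a‖) (n : ℕ) :
    ‖coeffT p s a n‖ ≤ (√((p : ℝ)⁻¹)) ^ n := by
  have ha0 : a ≠ 0 := norm_pos_iff.1 (one_pos.trans ha)
  refine le_trans ?_ (padic_pow_mul_inv_norm_factorial_le hodd n)
  have hprod : ‖∏ j ∈ Finset.Icc 1 (n - 1), (s - 1 + (j : ℚ_[p]))‖ ≤ 1 := by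
    rw [norm_prod]
    refine Finset.prod_le_one (fun _ _ => norm_nonneg _) fun j _ => ?_
    refine (Padic.nonarchimedean _ _).trans
      (max_le ?_ (IsUltrametricDist.norm_natCast_le_one _ j))
    rw [norm_sub_rev]
    exact padic_norm_one_sub_le_one hs
  have hinv : ‖a‖⁻¹ ≤ (p : ℝ)⁻¹ := by
    rw [← norm_inv]
    exact padic_norm_le_inv_of_lt_one (by rw [norm_inv]; exact inv_lt_one_of_one_lt₀ ha)
  rw [coeffT, norm_div, norm_mul, norm_pow, norm_omegaV ha0, div_eq_mul_inv, mul_inv, ← inv_pow]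
  calc _ ≤ 1 * (‖(n.factorial : ℚ_[p])‖⁻¹ * (‖a‖⁻¹) ^ n) := by gcongr
    _ ≤ _ := by rw [one_mul, mul_comm]; gcongr

end AlternatingSums

/-- Corollary on convergence of `T_p^a`: for an odd prime `p` and `a ∈ ℚ_p`
with `|a|_p > 1`, set `f(t) = ζ_{p,E}(t,a) - ⟨a⟩^{1-t}`.  For every `s ∈ ℤ_p` with `s ≠ 1`,
each inner series `∑_{k≥0} (n^k/k!) D^k f(s)` converges, and the series
`∑_{n≥0} P_n(s) · (∑_{k≥0} (n^k/k!) D^k f(s))` converges in `ℚ_p`. -/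
theorem padic_van_gorder_operator_convergence
    (p : ℕ) [Fact p.Prime] (hodd : p ≠ 2)
    (a : ℚ_[p]) (ha : 1 < ‖a‖)
    (f : ℚ_[p] → ℚ_[p]) (hf : ∀ t : ℚ_[p], f t = zetaE p t a - hpow p a (1 - t))
    (s : ℚ_[p]) (hs : ‖s‖ ≤ 1) (hs1 : s ≠ 1) :
    (∀ n : ℕ, Summable fun k : ℕ =>
      ((n : ℚ_[p]) ^ k / (k.factorial : ℚ_[p])) * iteratedDerivWithin k f (Zball p) s) ∧
    Summable (fun n : ℕ =>
      Pcoef p s a n *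
        ∑' k : ℕ,
          ((n : ℚ_[p]) ^ k / (k.factorial : ℚ_[p])) * iteratedDerivWithin k f (Zball p) s) := by
  have hρ0 : 0 ≤ √((p : ℝ)⁻¹) := Real.sqrt_nonneg _
  set σ : ℝ := √(√((p : ℝ)⁻¹)) with hσ
  have hσ0 : 0 ≤ σ := Real.sqrt_nonneg _
  have hσ1 : σ < 1 := by
    rw [hσ, Real.sqrt_lt' one_pos, one_pow]; exact sqrt_inv_prime_lt_one
  have hσ2 : σ ^ 2 = √((p : ℝ)⁻¹) := Real.sq_sqrt hρ0
  obtain ⟨B, hB, hBf⟩ := exists_zetaE_sub_hpow_eq_tsum hodd ha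
  have hb : ∀ n, ‖B n / (n.factorial : ℚ_[p])‖ ≤ (σ ^ 2) ^ n := fun n => by
    rw [hσ2, norm_div, div_eq_mul_inv]
    exact (mul_le_mul_of_nonneg_right (hB n) (by positivity)).trans
      (padic_pow_mul_inv_norm_factorial_le hodd n)
  have hcoef := norm_iteratedDerivWithin_div_factorial_le hσ0 hσ1 hb (F := f) (fun t ht => by
    rw [hf, hBf t ht]
    exact tsum_congr fun n => by rw [binom]; ring) hs
  have hinner : ∀ n k : ℕ, ‖((n : ℚ_[p]) ^ k / (k.factorial : ℚ_[p])) *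
      iteratedDerivWithin k f (Zball p) s‖ ≤ σ ^ k := fun n k => by
    rw [div_mul_eq_mul_div, mul_div_assoc, norm_mul]
    exact (mul_le_of_le_one_left (norm_nonneg _) (padic_norm_pow_le_one
      (IsUltrametricDist.norm_natCast_le_one _ n) k)).trans (hcoef k)
  refine ⟨fun n => Summable.of_norm_bounded (summable_geometric_of_lt_one hσ0 hσ1) (hinner n), ?_⟩
  rw [← summable_nat_add_iff 2]
  refine Summable.of_norm_bounded ((summable_nat_add_iff 2).2
    (summable_geometric_of_lt_one hρ0 sqrt_inv_prime_lt_one)) fun n => ?_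
  rw [norm_mul]
  refine (mul_le_of_le_one_right (norm_nonneg _) ?_).trans (norm_coeffT_le hodd hs ha (n + 2))
  exact IsUltrametricDist.norm_tsum_le_of_forall_le_of_nonneg zero_le_one fun k =>
    (hinner _ k).trans (pow_le_one₀ hσ0 hσ1.le)
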